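/- Let m and n be natural numbers with n ≥ 1, and define the Dirichlet kernel k_PBL(r) = (1/(2m+1)) · (1 + 2·Σ_{j=1}^m cos(j·r)) for r ∈ ℝ. Let x₁, …, xₙ ∈ ℝ, let σ > 0, and let K be the n × n matrix with entries K_{ij} = k_PBL(x_i - x_j). Then K is positive semidefinite and det(I_n + σ^{-2} K) ≤ (1 + n/((2m+1)·σ²))^{2m+1}. (Hence the maximum information gain of the Dirichlet kernel satisfies γ_n = O(log n).) -/

import Mathlib

open scoped BigOperators

/-- The Dirichlet kernel with parameter `m`:
`k_PBL(r) = (1/(2m+1)) (1 + 2 Σ_{j=1}^m cos(jr))`. -/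
noncomputable def dirichletKernel' (m : ℕ) (r : ℝ) : ℝ :=
  (1 / (2 * (m : ℝ) + 1)) * (1 + 2 * ∑ j ∈ Finset.Icc 1 m, Real.cos ((j : ℝ) * r))

lemma amgm_prod {ι : Type*} [Fintype ι] [Nonempty ι] (z : ι → ℝ) (hz : ∀ i, 0 ≤ z i) :
    ∏ i, z i ≤ ((∑ i, z i) / Fintype.card ι) ^ Fintype.card ι := by
  have hc : (0 : ℝ) < Fintype.card ι := by exact_mod_cast Fintype.card_pos
  have h := Real.geom_mean_le_arith_mean Finset.univ (fun _ : ι => (1 : ℝ)) z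
    (fun _ _ => zero_le_one) (by simp [Fintype.card_pos]) (fun i _ => hz i)
  simp only [Real.rpow_one, one_mul, Finset.sum_const, Finset.card_univ, nsmul_eq_mul,
    mul_one] at h
  have hp : 0 ≤ ∏ i, z i := Finset.prod_nonneg fun i _ => hz i
  calc ∏ i, z i = ((∏ i, z i) ^ ((Fintype.card ι : ℝ)⁻¹)) ^ Fintype.card ι :=
        (Real.rpow_inv_natCast_pow hp Fintype.card_ne_zero).symm
    _ ≤ _ := by gcongr

lemma det_le_trace {ι : Type*} [Fintype ι] [DecidableEq ι] [Nonempty ι] (M : Matrix ι ι ℝ)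
    (hM : M.PosSemidef) : M.det ≤ (M.trace / Fintype.card ι) ^ Fintype.card ι := by
  have h1 := hM.1.det_eq_prod_eigenvalues
  have h2 := hM.1.trace_eq_sum_eigenvalues
  simp only [RCLike.ofReal_real_eq_id, id] at h1 h2
  rw [h1, h2]
  exact amgm_prod _ hM.eigenvalues_nonneg

/-- real feature map of the Dirichlet kernel -/
noncomputable def dirFeat (m n : ℕ) (x : Fin n → ℝ) :
    Matrix (Fin n) (Unit ⊕ (Fin m ⊕ Fin m)) ℝ :=
  Matrix.of fun i s => match s with
    | Sum.inl _ => 1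
    | Sum.inr (Sum.inl j) => √2 * Real.cos (((j : ℕ) + 1 : ℝ) * x i)
    | Sum.inr (Sum.inr j) => √2 * Real.sin (((j : ℕ) + 1 : ℝ) * x i)

lemma gram_eq (m n : ℕ) (x : Fin n → ℝ) :
    Matrix.of (fun i j : Fin n => dirichletKernel' m (x i - x j)) =
      (1 / (2 * (m : ℝ) + 1)) • (dirFeat m n x * (dirFeat m n x).transpose) := by
  ext i j
  have h2 : √2 * √2 = (2 : ℝ) := Real.mul_self_sqrt (by norm_num)
  simp only [Matrix.of_apply, Matrix.smul_apply, smul_eq_mul, dirichletKernel', Matrix.mul_apply,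
    Matrix.transpose_apply, dirFeat, Fintype.sum_sum_type, Finset.univ_unique,
    Finset.sum_singleton, mul_one]
  congr 2
  rw [← Finset.sum_add_distrib, Finset.mul_sum, ← Finset.Ico_add_one_right_eq_Icc,
    Finset.sum_Ico_eq_sum_range, ← Fin.sum_univ_eq_sum_range
      (fun k => 2 * Real.cos (((1 + k : ℕ) : ℝ) * (x i - x j)))]
  refine Finset.sum_congr rfl fun k _ => ?_
  have : (((1 + (k : ℕ) : ℕ) : ℝ) * (x i - x j)) =
    ((k : ℕ) + 1 : ℝ) * x i - ((k : ℕ) + 1 : ℝ) * x j := by push_cast; ring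
  rw [this, Real.cos_sub]
  linear_combination (-(Real.cos (((k : ℕ) + 1 : ℝ) * x i) * Real.cos (((k : ℕ) + 1 : ℝ) * x j)
    + Real.sin (((k : ℕ) + 1 : ℝ) * x i) * Real.sin (((k : ℕ) + 1 : ℝ) * x j))) * h2

/-- The Gram matrix of the Dirichlet kernel is positive semidefinite and its regularized
log-determinant is bounded: `det(I + σ⁻²K) ≤ (1 + n/((2m+1)σ²))^{2m+1}`, whence the
maximum information gain of the Dirichlet kernel is `O(log n)`. -/
theorem dirichlet_kernel_det_bound (m n : ℕ) (hn : 1 ≤ n) (x : Fin n → ℝ)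
    (σ : ℝ) (hσ : 0 < σ) :
    (Matrix.of (fun i j : Fin n => dirichletKernel' m (x i - x j))).PosSemidef ∧
    Matrix.det
        (1 + (σ ^ 2)⁻¹ •
          Matrix.of (fun i j : Fin n => dirichletKernel' m (x i - x j))) ≤
      (1 + (n : ℝ) / ((2 * (m : ℝ) + 1) * σ ^ 2)) ^ (2 * m + 1) := by
  have hm : (0 : ℝ) < 2 * (m : ℝ) + 1 := by positivity
  have hB : (dirFeat m n x * (dirFeat m n x).transpose).PosSemidef := by
    simpa using Matrix.posSemidef_self_mul_conjTranspose (dirFeat m n x)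
  have hB' : ((dirFeat m n x).transpose * dirFeat m n x).PosSemidef := by
    simpa using Matrix.posSemidef_conjTranspose_mul_self (dirFeat m n x)
  have htr : ((σ ^ 2)⁻¹ • Matrix.of (fun i j : Fin n => dirichletKernel' m (x i - x j))).trace
      = n * (σ ^ 2)⁻¹ := by
    have h0 : dirichletKernel' m 0 = 1 := by
      simp only [dirichletKernel', mul_zero, Real.cos_zero, Finset.sum_const, Nat.card_Icc,
        nsmul_eq_mul, mul_one, Nat.add_sub_cancel]
      field_simp
      ring
    simp [Matrix.trace, h0]
  rw [gram_eq] at htr ⊢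
  refine ⟨hB.smul (by positivity), ?_⟩
  set B := dirFeat m n x
  rw [smul_smul] at htr ⊢
  set c := (σ ^ 2)⁻¹ * (1 / (2 * (m : ℝ) + 1)) with hc
  have hc0 : 0 ≤ c := by positivity
  have hdet : (1 + c • (B * B.transpose)).det = (1 + c • (B.transpose * B)).det := by
    rw [← Matrix.smul_mul, Matrix.det_one_add_mul_comm, Matrix.mul_smul]
  have hps : (1 + c • (B.transpose * B)).PosSemidef :=
    Matrix.PosSemidef.one.add (hB'.smul hc0)
  have hcard : Fintype.card (Unit ⊕ (Fin m ⊕ Fin m)) = 2 * m + 1 := by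
    simp; ring
  have h := det_le_trace _ hps
  rw [Matrix.trace_smul, Matrix.trace_mul_comm, ← Matrix.trace_smul] at htr
  rw [Matrix.trace_add, htr, Matrix.trace_one, hcard] at h
  rw [hdet]
  refine h.trans (le_of_eq ?_)
  congr 1
  push_cast
  field_simp
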